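/- Let n ≥ 1, let k₀, kₙ be positive integers, let α₀ = π/(2k₀) and αₙ = π/(2kₙ) be exceptional angles, let α₁,…,α_{n−1} ∈ (0,π) be non-exceptional, let ℓ = (ℓ₁,…,ℓₙ) ∈ (0,∞)ⁿ and σ ∈ ℝ. Write α' = (α₁,…,α_{n−1}) and α = (α₁,…,α_{n−1},αₙ), and let U(α',ℓ,σ) = B(ℓₙ,σ)·A(α_{n−1})·B(ℓ_{n−1},σ)⋯A(α₁)·B(ℓ₁,σ). Then U(α',ℓ,σ)X(α₀) · X(αₙ) = 0 holds if and only if: F_even(α,ℓ,σ) = 0 in the case (−1)^{k₀} = (−1)^{kₙ}, and F_odd(α,ℓ,σ) = 0 in the case (−1)^{k₀} ≠ (−1)^{kₙ}. (This is Theorem 2.16(b): the quasi-eigenvalues contributed by an exceptional boundary component joining exceptional angles α₀ and αₙ are the roots of F_even or F_odd according to whether the two exceptional angles have equal or different parity.) -/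

import Mathlib

open Matrix

/-- The vertex transfer matrix `A(α)` (for non-exceptional `α`). -/
noncomputable def Amat (α : ℝ) : Matrix (Fin 2) (Fin 2) ℂ :=
  !![((Real.sin (Real.pi ^ 2 / (2 * α)))⁻¹ : ℂ),
      -Complex.I * ((Real.cos (Real.pi ^ 2 / (2 * α)) / Real.sin (Real.pi ^ 2 / (2 * α)) : ℝ) : ℂ);
      Complex.I * ((Real.cos (Real.pi ^ 2 / (2 * α)) / Real.sin (Real.pi ^ 2 / (2 * α)) : ℝ) : ℂ),
      ((Real.sin (Real.pi ^ 2 / (2 * α)))⁻¹ : ℂ)]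

/-- The side transfer matrix `B(ℓ,σ) = diag(exp(iℓσ), exp(-iℓσ))`. -/
noncomputable def Bmat (ℓ σ : ℝ) : Matrix (Fin 2) (Fin 2) ℂ :=
  !![Complex.exp (Complex.I * ((ℓ * σ : ℝ) : ℂ)), 0;
      0, Complex.exp (-(Complex.I * ((ℓ * σ : ℝ) : ℂ)))]

/-- `C(α,ℓ,σ) = A(α) · B(ℓ,σ)`. -/
noncomputable def Cmat (α ℓ σ : ℝ) : Matrix (Fin 2) (Fin 2) ℂ := Amat α * Bmat ℓ σ

/-- The transfer matrix `T(α,ℓ,σ) = C(αₙ,ℓₙ,σ) ⋯ C(α₁,ℓ₁,σ)`. -/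
noncomputable def Tmat {n : ℕ} (α ℓ : Fin n → ℝ) (σ : ℝ) : Matrix (Fin 2) (Fin 2) ℂ :=
  ((List.ofFn fun j => Cmat (α j) (ℓ j) σ).reverse).prod

/-- The zigzag matrix
`U(α,ℓ,σ) = B(ℓ_{m+1},σ) A(α_m) B(ℓ_m,σ) ⋯ A(α₁) B(ℓ₁,σ)` for a zigzag with `m + 1` sides and
`m` interior angles. -/
noncomputable def Umat {m : ℕ} (αint : Fin m → ℝ) (ℓ : Fin (m + 1) → ℝ) (σ : ℝ) :
    Matrix (Fin 2) (Fin 2) ℂ :=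
  Bmat (ℓ (Fin.last m)) σ *
    ((List.ofFn fun j : Fin m => Amat (αint j) * Bmat (ℓ j.castSucc) σ).reverse).prod

/-- An angle is exceptional if it is of the form `π/(2k)` for a positive integer `k`. -/
def Exceptional (α : ℝ) : Prop := ∃ k : ℕ, 0 < k ∧ α = Real.pi / (2 * (k : ℝ))

/-- Cyclic successor on `Fin n`. -/
def cyc {n : ℕ} (j : Fin n) : Fin n :=
  ⟨(j.val + 1) % n, Nat.mod_lt _ (Nat.lt_of_le_of_lt (Nat.zero_le _) j.isLt)⟩

/-- The sign vector `ζ ∈ {±1}ⁿ` encoded by `ε : Fin n → Bool`. -/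
def sgnB {n : ℕ} (ε : Fin n → Bool) (j : Fin n) : ℝ := if ε j then 1 else -1

/-- Sign vectors `ζ ∈ {±1}ⁿ` with `ζ₁ = 1`. -/
def zSet (n : ℕ) : Finset (Fin n → Bool) :=
  Finset.univ.filter fun ε => ∀ j : Fin n, (j : ℕ) = 0 → ε j = true

/-- The dot product `ℓ · ζ`. -/
noncomputable def dotSgn {n : ℕ} (ℓ : Fin n → ℝ) (ε : Fin n → Bool) : ℝ :=
  ∑ j, ℓ j * sgnB ε j

/-- `𝔭_ζ(α) = ∏_{j ∈ Ch(ζ)} cos(π²/(2α_j))`, where `Ch(ζ)` is the set of indices of sign change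
of `ζ`, with the cyclic convention `ζ_{n+1} = ζ₁`. -/
noncomputable def pCoef {n : ℕ} (α : Fin n → ℝ) (ε : Fin n → Bool) : ℝ :=
  ∏ j ∈ Finset.univ.filter (fun j : Fin n => ε j ≠ ε (cyc j)),
    Real.cos (Real.pi ^ 2 / (2 * α j))

/-- `F_even(α,ℓ,σ) = Σ_{ζ ∈ {±1}ⁿ, ζ₁ = 1} 𝔭_ζ(α) cos((ℓ·ζ)σ)`. -/
noncomputable def Feven {n : ℕ} (α ℓ : Fin n → ℝ) (σ : ℝ) : ℝ :=
  ∑ ε ∈ zSet n, pCoef α ε * Real.cos (dotSgn ℓ ε * σ)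

/-- `F_odd(α,ℓ,σ) = Σ_{ζ ∈ {±1}ⁿ, ζ₁ = 1} 𝔭_ζ(α) sin((ℓ·ζ)σ)`. -/
noncomputable def Fodd {n : ℕ} (α ℓ : Fin n → ℝ) (σ : ℝ) : ℝ :=
  ∑ ε ∈ zSet n, pCoef α ε * Real.sin (dotSgn ℓ ε * σ)

/-- `X_even = (1/√2)(e^{-iπ/4}, e^{iπ/4})`. -/
noncomputable def Xeven : Fin 2 → ℂ :=
  ![((Real.sqrt 2)⁻¹ : ℂ) * Complex.exp (-(Complex.I * ((Real.pi / 4 : ℝ) : ℂ))),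
    ((Real.sqrt 2)⁻¹ : ℂ) * Complex.exp (Complex.I * ((Real.pi / 4 : ℝ) : ℂ))]

/-- `X_odd = (1/√2)(e^{iπ/4}, e^{-iπ/4})`. -/
noncomputable def Xodd : Fin 2 → ℂ :=
  ![((Real.sqrt 2)⁻¹ : ℂ) * Complex.exp (Complex.I * ((Real.pi / 4 : ℝ) : ℂ)),
    ((Real.sqrt 2)⁻¹ : ℂ) * Complex.exp (-(Complex.I * ((Real.pi / 4 : ℝ) : ℂ)))]

/-- The dot product on `ℂ²`: `u·v = u₁ conj(v₁) + u₂ conj(v₂)`. -/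
noncomputable def cdot (u v : Fin 2 → ℂ) : ℂ :=
  u 0 * starRingEnd ℂ (v 0) + u 1 * starRingEnd ℂ (v 1)

/-- The product of the cosine weights over the sign changes of `ζ` strictly inside the zigzag. -/
noncomputable def pathWeight {m : ℕ} (α : Fin m → ℝ) (ζ : Fin (m + 1) → Bool) : ℝ :=
  ∏ j : Fin m,
    if ζ j.castSucc ≠ ζ j.succ then Real.cos (Real.pi ^ 2 / (2 * α j)) else 1

/-- The contribution to the zigzag of the paths ending in the sign `b`, with initial weights `w`. -/
noncomputable def pathSum {m : ℕ} (α : Fin m → ℝ) (ℓ : Fin (m + 1) → ℝ) (σ : ℝ) (w : Bool → ℂ)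
    (b : Bool) : ℂ :=
  ∑ ζ : Fin (m + 1) → Bool, if ζ (Fin.last m) = b then
    w (ζ 0) * pathWeight α ζ * Complex.exp (Complex.I * ((dotSgn ℓ ζ * σ : ℝ) : ℂ)) else 0

theorem sum_snoc_bool {m : ℕ} (f : (Fin (m + 1) → Bool) → ℂ) :
    ∑ ζ, f ζ = ∑ b : Bool, ∑ ζ : Fin m → Bool, f (Fin.snoc ζ b) := by
  rw [← Fintype.sum_prod_type' (f := fun (b : Bool) (ζ : Fin m → Bool) => f (Fin.snoc ζ b))]
  exact (Fintype.sum_equiv (Fin.snocEquiv fun _ : Fin (m + 1) => Bool) _ _ fun _ => rfl).symm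

theorem pathWeight_snoc {m : ℕ} (α : Fin (m + 1) → ℝ) (ζ : Fin (m + 1) → Bool) (b : Bool) :
    pathWeight α (Fin.snoc ζ b) = pathWeight (fun j => α j.castSucc) ζ *
      if ζ (Fin.last m) ≠ b then Real.cos (Real.pi ^ 2 / (2 * α (Fin.last m))) else 1 := by
  simp only [pathWeight]
  rw [Fin.prod_univ_castSucc]
  simp only [Fin.snoc_castSucc, Fin.succ_last, Fin.snoc_last, Fin.succ_castSucc]

theorem dotSgn_snoc {m : ℕ} (ℓ : Fin (m + 1) → ℝ) (ζ : Fin m → Bool) (b : Bool) :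
    dotSgn ℓ (Fin.snoc ζ b) =
      dotSgn (fun j => ℓ j.castSucc) ζ + ℓ (Fin.last m) * (if b then 1 else -1) := by
  simp only [dotSgn, sgnB]
  rw [Fin.sum_univ_castSucc]
  simp only [Fin.snoc_castSucc, Fin.snoc_last]

theorem pathSum_succ {m : ℕ} (α : Fin (m + 1) → ℝ) (ℓ : Fin (m + 2) → ℝ) (σ : ℝ)
    (w : Bool → ℂ) (b : Bool) :
    pathSum α ℓ σ w b =
      Complex.exp (Complex.I * ((ℓ (Fin.last _) * (if b then 1 else -1) * σ : ℝ) : ℂ)) *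
        (pathSum (fun j => α j.castSucc) (fun j => ℓ j.castSucc) σ w b +
          Real.cos (Real.pi ^ 2 / (2 * α (Fin.last m))) *
            pathSum (fun j => α j.castSucc) (fun j => ℓ j.castSucc) σ w (!b)) := by
  have key : ∀ b' : Bool, (∑ ζ : Fin (m + 1) → Bool,
      if (Fin.snoc ζ b' : Fin (m + 2) → Bool) (Fin.last _) = b then
        w ((Fin.snoc ζ b' : Fin (m + 2) → Bool) 0) * pathWeight α (Fin.snoc ζ b') *
          Complex.exp (Complex.I * ((dotSgn ℓ (Fin.snoc ζ b') * σ : ℝ) : ℂ)) else 0) =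
      if b' = b then Complex.exp (Complex.I * ((ℓ (Fin.last _) * (if b then 1 else -1) * σ : ℝ) : ℂ)) *
        (pathSum (fun j => α j.castSucc) (fun j => ℓ j.castSucc) σ w b +
          Real.cos (Real.pi ^ 2 / (2 * α (Fin.last m))) *
            pathSum (fun j => α j.castSucc) (fun j => ℓ j.castSucc) σ w (!b)) else 0 := by
    intro b'
    by_cases h : b' = b
    · subst h
      simp only [Fin.snoc_last, if_true, pathSum, Finset.mul_sum, ← Finset.sum_add_distrib]
      refine Finset.sum_congr rfl fun ζ _ => ?_
      have h0 : (Fin.snoc ζ b' : Fin (m + 2) → Bool) 0 = ζ 0 := by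
        rw [← Fin.castSucc_zero, Fin.snoc_castSucc]
      rw [h0, pathWeight_snoc, dotSgn_snoc, add_mul, Complex.ofReal_add, mul_add, Complex.exp_add]
      by_cases hb : ζ (Fin.last m) = b'
      · simp [hb]; ring
      · have hb' : ζ (Fin.last m) = !b' := Bool.eq_not.2 hb
        simp [hb']; ring
    · simp [h]
  rw [pathSum, sum_snoc_bool]
  simp only [key, Finset.sum_ite_eq', Finset.mem_univ, if_true]

theorem Umat_succ {m : ℕ} (α : Fin (m + 1) → ℝ) (ℓ : Fin (m + 2) → ℝ) (σ : ℝ) :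
    Umat α ℓ σ = Bmat (ℓ (Fin.last _)) σ * (Amat (α (Fin.last m)) *
      Umat (fun j => α j.castSucc) (fun j => ℓ j.castSucc) σ) := by
  simp only [Umat]
  rw [List.ofFn_succ']
  simp [Matrix.mul_assoc]

theorem exp_quarter_mul_I :
    Complex.exp (-(Complex.I * ((Real.pi / 4 : ℝ) : ℂ))) * Complex.I =
      Complex.exp (Complex.I * ((Real.pi / 4 : ℝ) : ℂ)) := by
  nth_rewrite 2 [← Complex.exp_pi_div_two_mul_I]
  rw [← Complex.exp_add]
  congr 1
  push_cast
  ring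

/-- Up to conjugation by `diag(e^{-iπ/4}, e^{iπ/4})` and the factors `sin(π²/(2α_j))`, the zigzag
matrix sums over sign paths. -/
theorem Umat_mulVec_eq_pathSum {m : ℕ} (α : Fin m → ℝ) (ℓ : Fin (m + 1) → ℝ) (σ : ℝ)
    (hα : ∀ j, Real.sin (Real.pi ^ 2 / (2 * α j)) ≠ 0) (w : Bool → ℂ) (x : Fin 2 → ℂ)
    (hx0 : x 0 = Complex.exp (-(Complex.I * ((Real.pi / 4 : ℝ) : ℂ))) * w true)
    (hx1 : x 1 = Complex.exp (Complex.I * ((Real.pi / 4 : ℝ) : ℂ)) * w false) :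
    (∏ j, (Real.sin (Real.pi ^ 2 / (2 * α j)) : ℂ)) * (Umat α ℓ σ).mulVec x 0 =
        Complex.exp (-(Complex.I * ((Real.pi / 4 : ℝ) : ℂ))) * pathSum α ℓ σ w true ∧
      (∏ j, (Real.sin (Real.pi ^ 2 / (2 * α j)) : ℂ)) * (Umat α ℓ σ).mulVec x 1 =
        Complex.exp (Complex.I * ((Real.pi / 4 : ℝ) : ℂ)) * pathSum α ℓ σ w false := by
  induction m with
  | zero =>
    constructor
    · simp [Umat, Bmat, pathSum, pathWeight, dotSgn, sgnB, Matrix.mulVec, dotProduct,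
        Fin.sum_univ_two, sum_snoc_bool, hx0]
      simp [Fin.snoc]
      ring
    · simp [Umat, Bmat, pathSum, pathWeight, dotSgn, sgnB, Matrix.mulVec, dotProduct,
        Fin.sum_univ_two, sum_snoc_bool, hx1]
      simp [Fin.snoc]
      ring
  | succ m ih =>
    obtain ⟨h0, h1⟩ := ih (fun j => α j.castSucc) (fun j => ℓ j.castSucc) fun j => hα _
    have hs : (Real.sin (Real.pi ^ 2 / (2 * α (Fin.last m))) : ℂ) ≠ 0 := by
      exact_mod_cast hα (Fin.last m)
    have hI := exp_quarter_mul_I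
    rw [Umat_succ, ← Matrix.mulVec_mulVec, ← Matrix.mulVec_mulVec, Fin.prod_univ_castSucc,
      pathSum_succ, pathSum_succ]
    simp only [Bool.not_true, Bool.not_false]
    generalize (Umat (fun j => α j.castSucc) (fun j => ℓ j.castSucc) σ).mulVec x = u at h0 h1 ⊢
    generalize (∏ j : Fin m, (Real.sin (Real.pi ^ 2 / (2 * α j.castSucc)) : ℂ)) = P at h0 h1 ⊢
    generalize pathSum (fun j => α j.castSucc) (fun j => ℓ j.castSucc) σ w true = p at h0 h1 ⊢
    generalize pathSum (fun j => α j.castSucc) (fun j => ℓ j.castSucc) σ w false = q at h0 h1 ⊢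
    generalize Complex.exp (-(Complex.I * ((Real.pi / 4 : ℝ) : ℂ))) = e at h0 h1 hI ⊢
    rw [← hI] at h1 ⊢
    have hII := Complex.I_mul_I
    simp only [Amat, Bmat, Matrix.mulVec, dotProduct, Fin.sum_univ_two, Matrix.of_apply,
      Matrix.cons_val_zero, Matrix.cons_val_one, Complex.ofReal_div, if_true, Bool.false_eq_true,
      if_false, mul_one, mul_neg, neg_mul, Complex.ofReal_neg, zero_mul, zero_add, add_zero]
    generalize (Real.sin (Real.pi ^ 2 / (2 * α (Fin.last m))) : ℂ) = s at hs ⊢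
    generalize (Real.cos (Real.pi ^ 2 / (2 * α (Fin.last m))) : ℂ) = c
    generalize Complex.exp (Complex.I * ((ℓ (Fin.last (m + 1)) * σ : ℝ) : ℂ)) = E
    generalize Complex.exp (-(Complex.I * ((ℓ (Fin.last (m + 1)) * σ : ℝ) : ℂ))) = E'
    constructor
    · field_simp
      linear_combination E * h0 - E * c * Complex.I * h1 - E * c * e * q * hII
    · field_simp
      linear_combination E' * h1 + E' * c * Complex.I * h0

theorem sin_ne_zero_of_not_exceptional {α : ℝ} (h : α ∈ Set.Ioo 0 Real.pi)
    (hα : ¬ Exceptional α) : Real.sin (Real.pi ^ 2 / (2 * α)) ≠ 0 := by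
  intro hs
  obtain ⟨k, hk⟩ := Real.sin_eq_zero_iff.1 hs
  have hpi := Real.pi_pos
  have h0 : 0 < α := h.1
  have hk0 : (0 : ℝ) < k := by
    have : 0 < (k : ℝ) * Real.pi := hk ▸ by positivity
    exact pos_of_mul_pos_left this hpi.le
  lift k to ℕ using by exact_mod_cast hk0.le
  have hk0' : (0 : ℝ) < k := by exact_mod_cast hk0
  refine hα ⟨k, by exact_mod_cast hk0, ?_⟩
  push_cast at hk
  field_simp at hk ⊢
  linarith

theorem pCoef_snoc {m : ℕ} (α : Fin m → ℝ) (a : ℝ) (ζ : Fin (m + 1) → Bool) :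
    pCoef (Fin.snoc α a) ζ = pathWeight α ζ *
      if ζ (Fin.last m) ≠ ζ 0 then Real.cos (Real.pi ^ 2 / (2 * a)) else 1 := by
  have hc : ∀ j : Fin m, cyc j.castSucc = j.succ := fun j => by
    ext
    simp [cyc, Nat.mod_eq_of_lt]
  have hl : cyc (Fin.last m) = 0 := by
    ext
    simp [cyc]
  rw [pCoef, Finset.prod_filter, Fin.prod_univ_castSucc]
  simp only [hc, hl, Fin.snoc_castSucc, Fin.snoc_last, pathWeight]

theorem cos_exceptional {k : ℕ} (hk : 0 < k) :
    Real.cos (Real.pi ^ 2 / (2 * (Real.pi / (2 * (k : ℝ))))) = (-1) ^ k := by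
  have h : Real.pi ^ 2 / (2 * (Real.pi / (2 * (k : ℝ)))) = k * Real.pi := by
    have := Real.pi_ne_zero
    have : (k : ℝ) ≠ 0 := by exact_mod_cast hk.ne'
    field_simp
  rw [h, Real.cos_nat_mul_pi]

/-- Flipping all the signs. -/
theorem sum_eq_sum_zSet {m : ℕ} (f : (Fin (m + 1) → Bool) → ℂ) :
    ∑ ζ, f ζ = ∑ ζ ∈ zSet (m + 1), (f ζ + f fun j => !ζ j) := by
  have hz : zSet (m + 1) = Finset.univ.filter fun ζ => ζ 0 = true := by
    ext ζ
    simp only [zSet, Finset.mem_filter, Finset.mem_univ, true_and]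
    exact ⟨fun h => h 0 rfl, fun h j hj => by rwa [show j = 0 from Fin.ext hj]⟩
  rw [hz, Finset.sum_add_distrib, ← Finset.sum_filter_add_sum_filter_not Finset.univ
    (fun ζ : Fin (m + 1) → Bool => ζ 0 = true)]
  congr 1
  refine Finset.sum_nbij' (fun ζ j => !ζ j) (fun ζ j => !ζ j) ?_ ?_ ?_ ?_ ?_ <;> simp

theorem pCoef_not {n : ℕ} (α : Fin n → ℝ) (ζ : Fin n → Bool) :
    pCoef α (fun j => !ζ j) = pCoef α ζ := by
  simp [pCoef]

theorem dotSgn_not {n : ℕ} (ℓ : Fin n → ℝ) (ζ : Fin n → Bool) :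
    dotSgn ℓ (fun j => !ζ j) = -dotSgn ℓ ζ := by
  rw [dotSgn, dotSgn, ← Finset.sum_neg_distrib]
  refine Finset.sum_congr rfl fun j _ => ?_
  cases h : ζ j <;> simp [sgnB, h]

theorem sum_pCoef_exp_eq_Feven {m : ℕ} (α ℓ : Fin (m + 1) → ℝ) (σ : ℝ) :
    ∑ ζ, (pCoef α ζ : ℂ) * Complex.exp (Complex.I * ((dotSgn ℓ ζ * σ : ℝ) : ℂ)) =
      2 * Feven α ℓ σ := by
  rw [sum_eq_sum_zSet, Feven, Complex.ofReal_sum, Finset.mul_sum]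
  refine Finset.sum_congr rfl fun ζ _ => ?_
  rw [pCoef_not, dotSgn_not, neg_mul, Complex.ofReal_neg, Complex.ofReal_mul (pCoef α ζ), Complex.ofReal_cos,
    mul_comm Complex.I, mul_comm Complex.I]
  linear_combination -(pCoef α ζ : ℂ) * Complex.two_cos ((dotSgn ℓ ζ * σ : ℝ) : ℂ)

theorem sum_pCoef_exp_eq_Fodd {m : ℕ} (α ℓ : Fin (m + 1) → ℝ) (σ : ℝ) :
    ∑ ζ, (if ζ 0 then 1 else -1) * (pCoef α ζ : ℂ) *
        Complex.exp (Complex.I * ((dotSgn ℓ ζ * σ : ℝ) : ℂ)) =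
      2 * Complex.I * Fodd α ℓ σ := by
  rw [sum_eq_sum_zSet, Fodd, Complex.ofReal_sum, Finset.mul_sum]
  refine Finset.sum_congr rfl fun ζ hζ => ?_
  have h0 : ζ 0 = true := (Finset.mem_filter.1 hζ).2 0 rfl
  rw [pCoef_not, dotSgn_not, neg_mul, Complex.ofReal_neg, Complex.ofReal_mul (pCoef α ζ), Complex.ofReal_sin,
    mul_comm Complex.I, mul_comm Complex.I]
  simp only [h0, Bool.not_true, Bool.false_eq_true, if_true, if_false]
  linear_combination -(pCoef α ζ : ℂ) * Complex.I * Complex.two_sin ((dotSgn ℓ ζ * σ : ℝ) : ℂ) -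
    (pCoef α ζ : ℂ) * (Complex.exp (-((dotSgn ℓ ζ * σ : ℝ) : ℂ) * Complex.I) -
      Complex.exp (((dotSgn ℓ ζ * σ : ℝ) : ℂ) * Complex.I)) * Complex.I_mul_I

/-- The sign weights of the exceptional vector of an angle `π/(2k)`. -/
def parityWeight (k : ℕ) (b : Bool) : ℂ := if Even k then 1 else if b then 1 else -1

/-- The common phase of the two sign weights. -/
noncomputable def parityPhase (k : ℕ) : ℂ :=
  ((Real.sqrt 2)⁻¹ : ℂ) * if Even k then 1 else Complex.I

theorem parityPhase_ne_zero (k : ℕ) : parityPhase k ≠ 0 := by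
  unfold parityPhase
  split_ifs <;> simp

theorem exceptionalVector_apply (k : ℕ) :
    (if Even k then Xeven else Xodd) 0 = Complex.exp (-(Complex.I * ((Real.pi / 4 : ℝ) : ℂ))) *
        (parityPhase k * parityWeight k true) ∧
      (if Even k then Xeven else Xodd) 1 = Complex.exp (Complex.I * ((Real.pi / 4 : ℝ) : ℂ)) *
        (parityPhase k * parityWeight k false) := by
  have hI := exp_quarter_mul_I
  have hII := Complex.I_mul_I
  by_cases hk : Even k <;>
    simp only [hk, if_true, if_false, Xeven, Xodd, parityPhase, parityWeight, Bool.false_eq_true,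
      Matrix.cons_val_zero, Matrix.cons_val_one]
  · constructor <;> ring
  · rw [← hI]
    constructor
    · ring
    · linear_combination ((Real.sqrt 2)⁻¹ : ℂ) *
        Complex.exp (-(Complex.I * ((Real.pi / 4 : ℝ) : ℂ))) * hII

theorem conj_parityWeight (k : ℕ) (b : Bool) :
    starRingEnd ℂ (parityWeight k b) = parityWeight k b := by
  unfold parityWeight
  split_ifs <;> simp

theorem parityWeight_eq_mul (k : ℕ) (b b' : Bool) :
    parityWeight k b = parityWeight k b' * ((if b ≠ b' then (-1) ^ k else 1 : ℝ) : ℂ) := by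
  rcases Nat.even_or_odd k with hk | hk
  · simp [parityWeight, hk, hk.neg_one_pow]
  · cases b <;> cases b' <;> simp [parityWeight, Nat.not_even_iff_odd.2 hk, hk.neg_one_pow]

theorem sum_parityWeight_pathSum {m : ℕ} (α : Fin m → ℝ) (ℓ : Fin (m + 1) → ℝ) (σ : ℝ)
    (w : Bool → ℂ) {k : ℕ} (hk : 0 < k) :
    pathSum α ℓ σ w true * parityWeight k true + pathSum α ℓ σ w false * parityWeight k false =
      ∑ ζ, w (ζ 0) * parityWeight k (ζ 0) *
        (pCoef (Fin.snoc α (Real.pi / (2 * (k : ℝ))) : Fin (m + 1) → ℝ) ζ : ℂ) *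
          Complex.exp (Complex.I * ((dotSgn ℓ ζ * σ : ℝ) : ℂ)) := by
  simp only [pathSum, Finset.sum_mul, ← Finset.sum_add_distrib]
  refine Finset.sum_congr rfl fun ζ _ => ?_
  rw [pCoef_snoc, cos_exceptional hk, Complex.ofReal_mul (pathWeight α ζ)]
  have h := parityWeight_eq_mul k (ζ (Fin.last m)) (ζ 0)
  generalize ((if ζ (Fin.last m) ≠ ζ 0 then (-1) ^ k else 1 : ℝ) : ℂ) = r at h ⊢
  cases hb : ζ (Fin.last m) <;> rw [hb] at h <;> simp only [Bool.false_eq_true, reduceCtorEq,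
    if_true, if_false, h] <;> ring

theorem cdot_Umat_eq {m : ℕ} (α : Fin m → ℝ) (ℓ : Fin (m + 1) → ℝ) (σ : ℝ)
    (hα : ∀ j, Real.sin (Real.pi ^ 2 / (2 * α j)) ≠ 0) (k : ℕ) {k' : ℕ} (hk' : 0 < k') :
    (∏ j, (Real.sin (Real.pi ^ 2 / (2 * α j)) : ℂ)) *
        cdot ((Umat α ℓ σ).mulVec (if Even k then Xeven else Xodd))
          (if Even k' then Xeven else Xodd) =
      parityPhase k * starRingEnd ℂ (parityPhase k') *
        ∑ ζ, parityWeight k (ζ 0) * parityWeight k' (ζ 0) *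
          (pCoef (Fin.snoc α (Real.pi / (2 * (k' : ℝ))) : Fin (m + 1) → ℝ) ζ : ℂ) *
            Complex.exp (Complex.I * ((dotSgn ℓ ζ * σ : ℝ) : ℂ)) := by
  obtain ⟨hx0, hx1⟩ := exceptionalVector_apply k
  obtain ⟨hy0, hy1⟩ := exceptionalVector_apply k'
  obtain ⟨h0, h1⟩ := Umat_mulVec_eq_pathSum α ℓ σ hα
    (fun b => parityPhase k * parityWeight k b) _ hx0 hx1
  have hsum := sum_parityWeight_pathSum α ℓ σ (fun b => parityPhase k * parityWeight k b) hk'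
  have he : Complex.exp (Complex.I * ((Real.pi / 4 : ℝ) : ℂ)) *
      Complex.exp (-(Complex.I * ((Real.pi / 4 : ℝ) : ℂ))) = 1 := by
    rw [← Complex.exp_add, add_neg_cancel, Complex.exp_zero]
  simp only [mul_assoc, ← Finset.mul_sum] at hsum ⊢
  rw [cdot, hy0, hy1]
  simp only [map_mul, conj_parityWeight, ← Complex.exp_conj, map_neg, Complex.conj_I,
    Complex.conj_ofReal, neg_mul, neg_neg]
  rw [mul_left_comm (parityPhase k), ← hsum]
  linear_combination
    Complex.exp (Complex.I * ((Real.pi / 4 : ℝ) : ℂ)) * starRingEnd ℂ (parityPhase k') *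
        parityWeight k' true * h0 +
      Complex.exp (-(Complex.I * ((Real.pi / 4 : ℝ) : ℂ))) * starRingEnd ℂ (parityPhase k') *
        parityWeight k' false * h1 +
      starRingEnd ℂ (parityPhase k') *
        (pathSum α ℓ σ (fun b => parityPhase k * parityWeight k b) true * parityWeight k' true +
          pathSum α ℓ σ (fun b => parityPhase k * parityWeight k b) false *
            parityWeight k' false) * he

theorem parityWeight_mul_of_eq {k k' : ℕ} (h : (-1 : ℝ) ^ k = (-1 : ℝ) ^ k') (b : Bool) :
    parityWeight k b * parityWeight k' b = 1 := by
  rcases Nat.even_or_odd k with hk | hk <;> rcases Nat.even_or_odd k' with hk' | hk' <;>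
    rw [hk.neg_one_pow, hk'.neg_one_pow] at h
  · simp [parityWeight, hk, hk']
  · norm_num at h
  · norm_num at h
  · cases b <;> simp [parityWeight, Nat.not_even_iff_odd.2 hk, Nat.not_even_iff_odd.2 hk']

theorem parityWeight_mul_of_ne {k k' : ℕ} (h : (-1 : ℝ) ^ k ≠ (-1 : ℝ) ^ k') (b : Bool) :
    parityWeight k b * parityWeight k' b = if b then 1 else -1 := by
  rcases Nat.even_or_odd k with hk | hk <;> rcases Nat.even_or_odd k' with hk' | hk' <;>
    rw [hk.neg_one_pow, hk'.neg_one_pow] at h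
  · exact absurd rfl h
  · simp [parityWeight, hk, Nat.not_even_iff_odd.2 hk']
  · simp [parityWeight, Nat.not_even_iff_odd.2 hk, hk']
  · exact absurd rfl h

theorem cdot_Umat_eq_zero_iff {m : ℕ} (α : Fin m → ℝ) (ℓ : Fin (m + 1) → ℝ) (σ : ℝ)
    (hα : ∀ j, Real.sin (Real.pi ^ 2 / (2 * α j)) ≠ 0) (k : ℕ) {k' : ℕ} (hk' : 0 < k') :
    cdot ((Umat α ℓ σ).mulVec (if Even k then Xeven else Xodd))
        (if Even k' then Xeven else Xodd) = 0 ↔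
      ∑ ζ, parityWeight k (ζ 0) * parityWeight k' (ζ 0) *
        (pCoef (Fin.snoc α (Real.pi / (2 * (k' : ℝ))) : Fin (m + 1) → ℝ) ζ : ℂ) *
          Complex.exp (Complex.I * ((dotSgn ℓ ζ * σ : ℝ) : ℂ)) = 0 := by
  have hP : (∏ j, (Real.sin (Real.pi ^ 2 / (2 * α j)) : ℂ)) ≠ 0 :=
    Finset.prod_ne_zero_iff.2 fun j _ => by exact_mod_cast hα j
  have hph : parityPhase k * starRingEnd ℂ (parityPhase k') ≠ 0 :=
    mul_ne_zero (parityPhase_ne_zero k) ((map_ne_zero _).2 (parityPhase_ne_zero k'))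
  rw [← mul_eq_zero_iff_left hP, cdot_Umat_eq α ℓ σ hα k hk', mul_eq_zero,
    or_iff_right hph]

/-- **Theorem 2.16(b).** For an exceptional boundary component with `m+1` sides joining the
exceptional angles `α₀ = π/(2k₀)` and `α_{m+1} = π/(2k_{m+1})` through non-exceptional interior
angles `α₁,…,α_m`, the equation `U(α',ℓ,σ)X(α₀) · X(α_{m+1}) = 0` holds iff
`F_even(α,ℓ,σ) = 0` when the two exceptional angles have the same parity, and iff
`F_odd(α,ℓ,σ) = 0` when their parities differ; here `α = (α₁,…,α_m, π/(2k_{m+1}))`. -/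
theorem stmt5 (m : ℕ) (k0 kn : ℕ) (hk0 : 0 < k0) (hkn : 0 < kn)
    (αint : Fin m → ℝ)
    (hαint : ∀ j, αint j ∈ Set.Ioo 0 Real.pi ∧ ¬ Exceptional (αint j))
    (ℓ : Fin (m + 1) → ℝ) (hℓ : ∀ j, 0 < ℓ j) (σ : ℝ) :
    (((-1 : ℝ) ^ k0 = (-1 : ℝ) ^ kn) →
      (cdot ((Umat αint ℓ σ).mulVec (if Even k0 then Xeven else Xodd))
          (if Even kn then Xeven else Xodd) = 0 ↔
        Feven (Fin.snoc αint (Real.pi / (2 * (kn : ℝ)))) ℓ σ = 0)) ∧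
    (((-1 : ℝ) ^ k0 ≠ (-1 : ℝ) ^ kn) →
      (cdot ((Umat αint ℓ σ).mulVec (if Even k0 then Xeven else Xodd))
          (if Even kn then Xeven else Xodd) = 0 ↔
        Fodd (Fin.snoc αint (Real.pi / (2 * (kn : ℝ)))) ℓ σ = 0)) := by
  have hs : ∀ j, Real.sin (Real.pi ^ 2 / (2 * αint j)) ≠ 0 := fun j =>
    sin_ne_zero_of_not_exceptional (hαint j).1 (hαint j).2
  refine ⟨fun h => ?_, fun h => ?_⟩
  · rw [cdot_Umat_eq_zero_iff αint ℓ σ hs k0 hkn]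
    simp only [parityWeight_mul_of_eq h, one_mul]
    rw [sum_pCoef_exp_eq_Feven]
    simp
  · rw [cdot_Umat_eq_zero_iff αint ℓ σ hs k0 hkn]
    simp only [parityWeight_mul_of_ne h]
    rw [sum_pCoef_exp_eq_Fodd]
    simp
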